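/- arXiv:math/0110146 — 2 statements merged into one kernel-verified Lean document; each statement's English description precedes it below -/
import Mathlib

section
/- Let X be a separable Banach space with norm ‖·‖ and let |||·||| be the asymptotic norm generated by ‖·‖ (via a countable dense set C and weights (p_c)). Let (x_m)_{m∈ω} and (y_n)_{n∈ω} be |||·|||-normalized weakly null sequences in X with lim_{m→∞} lim_{n→∞} |||x_m + y_n||| = 1. Then there exist integers k(0) < k(1) < ⋯ such that, setting a := lim_{m→∞} ‖x_{k(m)}‖ and x'_m := x_{k(m)} / ‖x_{k(m)}‖, for all y ∈ X one has lim_{m→∞} lim_{n→∞} ‖y + x'_m + a^{−1} y_{k(n)}‖ = lim_{m→∞} ‖y + x'_m‖ (all the indicated limits existing). -/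
open Filter Finset Topology

variable {X : Type*} [NormedAddCommGroup X] [NormedSpace ℝ X]

/-- The norm `‖x‖_c = ‖c‖x‖ + x‖ + ‖c‖x‖ - x‖` summed with weights `p c` over the countable
dense set `C`: the asymptotic norm `|||·|||` generated by `‖·‖`. -/
noncomputable def tripNorm (C : Set X) (p : X → ℝ) (x : X) : ℝ :=
  ∑' c : C, p (c : X) * (‖‖x‖ • (c : X) + x‖ + ‖‖x‖ • (c : X) - x‖)

/-- `(x i)` is weakly null. -/
def WeaklyNull (x : ℕ → X) : Prop :=
  ∀ f : X →L[ℝ] ℝ, Filter.Tendsto (fun i => f (x i)) Filter.atTop (nhds 0)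

/-- `IterLim2 F L`: the iterated limit `lim_{m→∞} lim_{n→∞} F m n` exists and equals `L`. -/
def IterLim2 (F : ℕ → ℕ → ℝ) (L : ℝ) : Prop :=
  ∃ g : ℕ → ℝ, (∀ m, Filter.Tendsto (fun n => F m n) Filter.atTop (nhds (g m))) ∧
    Filter.Tendsto g Filter.atTop (nhds L)

lemma norm_smul_add_add_norm_smul_sub_mono {X : Type*} [NormedAddCommGroup X] [NormedSpace ℝ X]
    (c w : X) {s t : ℝ} (hs : 0 ≤ s) (hst : s ≤ t) :
    ‖s • c + w‖ + ‖s • c - w‖ ≤ ‖t • c + w‖ + ‖t • c - w‖ := by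
  rcases (hs.trans hst).eq_or_lt with rfl | ht
  · rw [le_antisymm hst hs]
  have hq : s / t ≤ 1 := (div_le_one ht).2 hst
  have hq0 : 0 ≤ s / t := by positivity
  have hqt : s / t * t = s := div_mul_cancel₀ s ht.ne'
  generalize s / t = q at hq hq0 hqt
  subst hqt
  have h1 : (q * t) • c + w = ((1 + q) / 2) • (t • c + w) - ((1 - q) / 2) • (t • c - w) := by
    module
  have h2 : (q * t) • c - w = ((1 + q) / 2) • (t • c - w) - ((1 - q) / 2) • (t • c + w) := by
    module
  have e1 : ‖(q * t) • c + w‖ ≤ (1 + q) / 2 * ‖t • c + w‖ + (1 - q) / 2 * ‖t • c - w‖ := by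
    rw [h1]
    refine (norm_sub_le _ _).trans_eq ?_
    rw [norm_smul, norm_smul, Real.norm_of_nonneg (by linarith), Real.norm_of_nonneg (by linarith)]
  have e2 : ‖(q * t) • c - w‖ ≤ (1 + q) / 2 * ‖t • c - w‖ + (1 - q) / 2 * ‖t • c + w‖ := by
    rw [h2]
    refine (norm_sub_le _ _).trans_eq ?_
    rw [norm_smul, norm_smul, Real.norm_of_nonneg (by linarith), Real.norm_of_nonneg (by linarith)]
  linarith

lemma norm_smul_add_add_norm_smul_sub_le {X : Type*} [NormedAddCommGroup X] [NormedSpace ℝ X]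
    (c x : X) : ‖‖x‖ • c + x‖ + ‖‖x‖ • c - x‖ ≤ 2 * ‖x‖ * (1 + ‖c‖) := by
  have h1 := norm_add_le (‖x‖ • c) x
  have h2 := norm_sub_le (‖x‖ • c) x
  rw [norm_smul, norm_norm] at h1 h2
  linarith

lemma two_mul_norm_le_norm_add_add_norm_sub {X : Type*} [NormedAddCommGroup X] [NormedSpace ℝ X]
    (u x : X) : 2 * ‖x‖ ≤ ‖u + x‖ + ‖u - x‖ := by
  have h := norm_sub_le (u + x) (u - x)
  rw [show u + x - (u - x) = (2 : ℝ) • x by module, norm_smul] at h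
  simpa using h

lemma summable_tripNorm {X : Type*} [NormedAddCommGroup X] [NormedSpace ℝ X]
    {C : Set X} {p : X → ℝ} (hp : ∀ c ∈ C, 0 < p c)
    (hsum : Summable fun c : C => p (c : X) * (1 + ‖(c : X)‖)) (x : X) :
    Summable fun c : C => p (c : X) * (‖‖x‖ • (c : X) + x‖ + ‖‖x‖ • (c : X) - x‖) := by
  refine Summable.of_nonneg_of_le (fun c => ?_) (fun c => ?_) (hsum.mul_left (2 * ‖x‖))
  · have := hp c c.2
    positivity
  · have := mul_le_mul_of_nonneg_left (norm_smul_add_add_norm_smul_sub_le (c : X) x)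
      (hp c c.2).le
    linarith

lemma tripNorm_le {X : Type*} [NormedAddCommGroup X] [NormedSpace ℝ X]
    {C : Set X} {p : X → ℝ} (hp : ∀ c ∈ C, 0 < p c)
    (hsum : Summable fun c : C => p (c : X) * (1 + ‖(c : X)‖)) (x : X) :
    tripNorm C p x ≤ 2 * ‖x‖ * ∑' c : C, p (c : X) * (1 + ‖(c : X)‖) := by
  rw [← tsum_mul_left]
  refine (summable_tripNorm hp hsum x).tsum_le_tsum (fun c => ?_) (hsum.mul_left _)
  have := mul_le_mul_of_nonneg_left (norm_smul_add_add_norm_smul_sub_le (c : X) x) (hp c c.2).le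
  linarith

lemma mul_norm_le_tripNorm {X : Type*} [NormedAddCommGroup X] [NormedSpace ℝ X]
    {C : Set X} {p : X → ℝ} (hp : ∀ c ∈ C, 0 < p c)
    (hsum : Summable fun c : C => p (c : X) * (1 + ‖(c : X)‖)) {c : X} (hc : c ∈ C) (x : X) :
    p c * (2 * ‖x‖) ≤ tripNorm C p x := by
  refine (mul_le_mul_of_nonneg_left
    (two_mul_norm_le_norm_add_add_norm_sub (‖x‖ • c) x) (hp c hc).le).trans ?_
  refine (summable_tripNorm hp hsum x).le_tsum (⟨c, hc⟩ : C) fun d _ => ?_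
  have := hp d d.2
  positivity

lemma abs_norm_add_sub_norm_add_le {X : Type*} [NormedAddCommGroup X] (z w v : X) :
    |‖z + v‖ - ‖w + v‖| ≤ ‖z - w‖ := by
  simpa using abs_norm_sub_norm_le (z + v) (w + v)

lemma exists_tendsto_norm_add_of_dense {X : Type*} [NormedAddCommGroup X]
    {C : Set X} (hC : Dense C) {v : ℕ → X}
    (h : ∀ c ∈ C, ∃ l, Tendsto (fun n => ‖c + v n‖) atTop (𝓝 l)) (z : X) :
    ∃ l, Tendsto (fun n => ‖z + v n‖) atTop (𝓝 l) := by
  refine cauchySeq_tendsto_of_complete (Metric.cauchySeq_iff.2 fun ε hε => ?_)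
  obtain ⟨c, hc, hzc⟩ := hC.exists_dist_lt z (show 0 < ε / 3 by positivity)
  obtain ⟨l, hl⟩ := h c hc
  obtain ⟨N, hN⟩ := Metric.cauchySeq_iff.1 hl.cauchySeq (ε / 3) (by positivity)
  refine ⟨N, fun m hm n hn => ?_⟩
  have h1 := hN m hm n hn
  have h2 := abs_le.1 (abs_norm_add_sub_norm_add_le z c (v m))
  have h3 := abs_le.1 (abs_norm_add_sub_norm_add_le z c (v n))
  rw [dist_eq_norm] at hzc
  rw [Real.dist_eq, abs_lt] at h1 ⊢
  constructor <;> linarith [h1.1, h1.2, h2.1, h2.2, h3.1, h3.2]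

/-- In a separable space, two bounded sequences have common subsequences along which all distance
functions converge. -/
lemma exists_subseq_tendsto_norm_add {X : Type*} [NormedAddCommGroup X]
    {C : Set X} (hCc : C.Countable) (hCd : Dense C) {x y : ℕ → X} {M : ℝ}
    (hx : ∀ n, ‖x n‖ ≤ M) (hy : ∀ n, ‖y n‖ ≤ M) :
    ∃ k : ℕ → ℕ, StrictMono k ∧ ∃ φ ψ : X → ℝ,
      (∀ z, Tendsto (fun n => ‖z + x (k n)‖) atTop (𝓝 (φ z))) ∧
      ∀ z, Tendsto (fun n => ‖z + y (k n)‖) atTop (𝓝 (ψ z)) := by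
  have := hCc.to_subtype
  let K : Set (C → ℝ × ℝ) := Set.univ.pi fun c =>
    Set.Icc 0 (‖(c : X)‖ + M) ×ˢ Set.Icc 0 (‖(c : X)‖ + M)
  have hK : IsCompact K := isCompact_univ_pi fun c => isCompact_Icc.prod isCompact_Icc
  obtain ⟨l, -, k, hk, hl⟩ := hK.tendsto_subseq
    (x := fun n (c : C) => (‖(c : X) + x n‖, ‖(c : X) + y n‖)) fun n c _ =>
      ⟨⟨norm_nonneg _, (norm_add_le _ _).trans (by gcongr; exact hx n)⟩,
        ⟨norm_nonneg _, (norm_add_le _ _).trans (by gcongr; exact hy n)⟩⟩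
  rw [tendsto_pi_nhds] at hl
  choose φ hφ using exists_tendsto_norm_add_of_dense hCd (v := x ∘ k) fun c hc =>
    ⟨_, (hl ⟨c, hc⟩).fst_nhds⟩
  choose ψ hψ using exists_tendsto_norm_add_of_dense hCd (v := y ∘ k) fun c hc =>
    ⟨_, (hl ⟨c, hc⟩).snd_nhds⟩
  exact ⟨k, hk, φ, ψ, hφ, hψ⟩

lemma tendsto_norm_add_of_tendsto {X : Type*} [NormedAddCommGroup X] {v z : ℕ → X} {w : X}
    {l : ℝ} (h : Tendsto (fun n => ‖w + v n‖) atTop (𝓝 l)) (hz : Tendsto z atTop (𝓝 w)) :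
    Tendsto (fun n => ‖z n + v n‖) atTop (𝓝 l) := by
  have h0 : Tendsto (fun n => ‖z n + v n‖ - ‖w + v n‖) atTop (𝓝 0) :=
    squeeze_zero_norm (fun n => abs_norm_add_sub_norm_add_le _ _ _)
      (tendsto_iff_norm_sub_tendsto_zero.1 hz)
  simpa using h0.add h

lemma abs_sub_le_of_tendsto_norm_add {X : Type*} [NormedAddCommGroup X] {v : ℕ → X} {ψ : X → ℝ}
    (hψ : ∀ z, Tendsto (fun n => ‖z + v n‖) atTop (𝓝 (ψ z))) (z w : X) :
    |ψ z - ψ w| ≤ ‖z - w‖ :=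
  le_of_tendsto ((hψ z).sub (hψ w)).abs
    (Eventually.of_forall fun n => abs_norm_add_sub_norm_add_le z w (v n))

lemma norm_le_of_tendsto_norm_add {X : Type*} [NormedAddCommGroup X] [NormedSpace ℝ X]
    {v : ℕ → X} (hv : WeaklyNull v) {z : X} {l : ℝ}
    (h : Tendsto (fun n => ‖z + v n‖) atTop (𝓝 l)) : ‖z‖ ≤ l := by
  obtain ⟨f, hf, hfz⟩ := exists_dual_vector'' ℝ z
  have h1 : Tendsto (fun n => f (z + v n)) atTop (𝓝 ‖z‖) := by
    simpa [hfz] using (hv f).const_add (f z)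
  refine le_of_tendsto_of_tendsto' h1 h fun n => ?_
  calc f (z + v n) ≤ ‖f (z + v n)‖ := le_abs_self _
    _ ≤ ‖f‖ * ‖z + v n‖ := f.le_opNorm _
    _ ≤ ‖z + v n‖ := mul_le_of_le_one_left (norm_nonneg _) hf

/-- The defect in weak lower semicontinuity of the norm at `‖x‖ • c + x` is controlled by the one
of the asymptotic norm at `x`. -/
lemma mul_sub_norm_le_of_tendsto_tripNorm {X : Type*} [NormedAddCommGroup X] [NormedSpace ℝ X]
    {C : Set X} {p : X → ℝ} (hp : ∀ c ∈ C, 0 < p c)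
    (hsum : Summable fun c : C => p (c : X) * (1 + ‖(c : X)‖))
    {v : ℕ → X} (hv : WeaklyNull v) {M : ℝ} (hM : ∀ n, ‖v n‖ ≤ M) {ψ : X → ℝ}
    (hψ : ∀ z, Tendsto (fun n => ‖z + v n‖) atTop (𝓝 (ψ z))) {x : X} {L : ℝ}
    (hL : Tendsto (fun n => tripNorm C p (x + v n)) atTop (𝓝 L)) {c : X} (hc : c ∈ C) :
    p c * (ψ (‖x‖ • c + x) - ‖‖x‖ • c + x‖) ≤ L - tripNorm C p x := by
  have hle : ∀ z, ‖z‖ ≤ ψ z := fun z => norm_le_of_tendsto_norm_add hv (hψ z)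
  have hplus : ∀ {t : ℕ → ℝ} {s : ℝ} (d : X), Tendsto t atTop (𝓝 s) →
      Tendsto (fun n => ‖t n • d + (x + v n)‖) atTop (𝓝 (ψ (s • d + x))) := by
    intro t s d ht
    simpa only [add_assoc] using
      tendsto_norm_add_of_tendsto (hψ (s • d + x)) ((ht.smul_const d).add_const x)
  have hminus : ∀ {t : ℕ → ℝ} {s : ℝ} (d : X), Tendsto t atTop (𝓝 s) →
      Tendsto (fun n => ‖t n • d - (x + v n)‖) atTop (𝓝 (ψ (x - s • d))) := by
    intro t s d ht
    refine (tendsto_norm_add_of_tendsto (hψ (x - s • d))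
      ((ht.smul_const d).const_sub x)).congr fun n => ?_
    rw [← norm_neg]
    congr 1
    abel
  have hmono : ∀ d : X, ψ (‖x‖ • d + x) + ψ (x - ‖x‖ • d) ≤
      ψ (ψ x • d + x) + ψ (x - ψ x • d) := fun d =>
    le_of_tendsto_of_tendsto'
      ((hplus d tendsto_const_nhds).add (hminus d tendsto_const_nhds))
      ((hplus d tendsto_const_nhds).add (hminus d tendsto_const_nhds)) fun n =>
      norm_smul_add_add_norm_smul_sub_mono d (x + v n) (norm_nonneg x) (hle x)
  have hbound : Summable fun d : C => 2 * (‖x‖ + M) * (p (d : X) * (1 + ‖(d : X)‖)) :=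
    hsum.mul_left _
  have hterm : ∀ n (d : C), ‖p (d : X) * (‖‖x + v n‖ • (d : X) + (x + v n)‖ +
      ‖‖x + v n‖ • (d : X) - (x + v n)‖)‖ ≤ 2 * (‖x‖ + M) * (p (d : X) * (1 + ‖(d : X)‖)) := by
    intro n d
    have hpd := hp d d.2
    rw [Real.norm_of_nonneg (by positivity)]
    have h1 := norm_smul_add_add_norm_smul_sub_le (d : X) (x + v n)
    have h2 : ‖x + v n‖ ≤ ‖x‖ + M := (norm_add_le _ _).trans (by gcongr; exact hM n)
    calc _ ≤ p (d : X) * (2 * ‖x + v n‖ * (1 + ‖(d : X)‖)) := by gcongr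
      _ ≤ p (d : X) * (2 * (‖x‖ + M) * (1 + ‖(d : X)‖)) := by gcongr
      _ = _ := by ring
  have hconv : ∀ d : C, Tendsto (fun n => p (d : X) * (‖‖x + v n‖ • (d : X) + (x + v n)‖ +
      ‖‖x + v n‖ • (d : X) - (x + v n)‖)) atTop
      (𝓝 (p (d : X) * (ψ (ψ x • (d : X) + x) + ψ (x - ψ x • (d : X))))) := fun d =>
    ((hplus (d : X) (hψ x)).add (hminus (d : X) (hψ x))).const_mul _
  have hLeq : L = ∑' d : C, p (d : X) * (ψ (ψ x • (d : X) + x) + ψ (x - ψ x • (d : X))) :=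
    tendsto_nhds_unique hL (tendsto_tsum_of_dominated_convergence hbound hconv
      (Eventually.of_forall hterm))
  have hS : Summable fun d : C =>
      p (d : X) * (ψ (ψ x • (d : X) + x) + ψ (x - ψ x • (d : X))) :=
    Summable.of_norm_bounded hbound fun d =>
      le_of_tendsto (hconv d).norm (Eventually.of_forall fun n => hterm n d)
  have hT := summable_tripNorm hp hsum x
  have hdiff : ∀ d : C, p (d : X) * (ψ (‖x‖ • (d : X) + x) - ‖‖x‖ • (d : X) + x‖) ≤
      p (d : X) * (ψ (ψ x • (d : X) + x) + ψ (x - ψ x • (d : X))) -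
        p (d : X) * (‖‖x‖ • (d : X) + x‖ + ‖‖x‖ • (d : X) - x‖) := by
    intro d
    rw [← mul_sub]
    refine mul_le_mul_of_nonneg_left ?_ (hp d d.2).le
    have h1 := hle (x - ‖x‖ • (d : X))
    rw [norm_sub_rev] at h1
    linarith [hmono (d : X)]
  rw [hLeq, tripNorm, ← hS.tsum_sub hT]
  refine (hdiff ⟨c, hc⟩).trans ((hS.sub hT).le_tsum (⟨c, hc⟩ : C) fun d _ => ?_)
  exact (mul_nonneg (hp d d.2).le (sub_nonneg.2 (hle _))).trans (hdiff d)

/-- Lemma 4.3. -/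
theorem stmt_15 {X : Type*} [NormedAddCommGroup X] [NormedSpace ℝ X] [CompleteSpace X]
    [TopologicalSpace.SeparableSpace X]
    (C : Set X) (hCc : C.Countable) (hCd : Dense C)
    (p : X → ℝ) (hp : ∀ c ∈ C, 0 < p c)
    (hsum : Summable fun c : C => p (c : X) * (1 + ‖(c : X)‖))
    (x y : ℕ → X) (hx : ∀ m, tripNorm C p (x m) = 1) (hy : ∀ n, tripNorm C p (y n) = 1)
    (hxw : WeaklyNull x) (hyw : WeaklyNull y)
    (hlim : IterLim2 (fun m n => tripNorm C p (x m + y n)) 1) :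
    ∃ k : ℕ → ℕ, StrictMono k ∧ ∃ a : ℝ,
      Filter.Tendsto (fun m => ‖x (k m)‖) Filter.atTop (nhds a) ∧
      ∀ y₀ : X, ∃ L : ℝ,
        Filter.Tendsto (fun m => ‖y₀ + ‖x (k m)‖⁻¹ • x (k m)‖) Filter.atTop (nhds L) ∧
        IterLim2 (fun m n => ‖y₀ + ‖x (k m)‖⁻¹ • x (k m) + a⁻¹ • y (k n)‖) L := by
  obtain ⟨c₀, hc₀⟩ := hCd.nonempty
  have hbd : ∀ z : X, tripNorm C p z = 1 → ‖z‖ ≤ 1 / (2 * p c₀) := by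
    intro z hz
    have h := mul_norm_le_tripNorm hp hsum hc₀ z
    have := hp c₀ hc₀
    rw [le_div_iff₀ (by positivity)]
    linarith
  obtain ⟨k, hk, φ, ψ, hφ, hψ⟩ := exists_subseq_tendsto_norm_add hCc hCd
    (fun n => hbd _ (hx n)) (fun n => hbd _ (hy n))
  have hya : WeaklyNull (y ∘ k) := fun f => (hyw f).comp hk.tendsto_atTop
  have hle : ∀ z, ‖z‖ ≤ ψ z := fun z => norm_le_of_tendsto_norm_add hya (hψ z)
  have ha : Tendsto (fun m => ‖x (k m)‖) atTop (𝓝 (φ 0)) := by simpa using hφ 0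
  set a := φ 0
  have ha0 : 0 < a := by
    have h1 : 1 ≤ 2 * a * ∑' c : C, p (c : X) * (1 + ‖(c : X)‖) :=
      ge_of_tendsto' ((ha.const_mul 2).mul_const _) fun m =>
        (hx (k m)).symm.le.trans (tripNorm_le hp hsum _)
    have h2 : 0 ≤ a := ge_of_tendsto' ha fun m => norm_nonneg _
    rcases h2.eq_or_lt with h | h
    · rw [← h] at h1
      norm_num at h1
    · exact h
  obtain ⟨g, hg, hg1⟩ := hlim
  have hdefect : ∀ c ∈ C, Tendsto (fun m => ψ (‖x (k m)‖ • c + x (k m)) -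
      ‖‖x (k m)‖ • c + x (k m)‖) atTop (𝓝 0) := by
    intro c hc
    have hpc := hp c hc
    have hlim0 : Tendsto (fun m => (p c)⁻¹ * (g (k m) - 1)) atTop (𝓝 0) := by
      simpa using ((hg1.comp hk.tendsto_atTop).sub_const 1).const_mul (p c)⁻¹
    refine squeeze_zero (fun m => sub_nonneg.2 (hle _)) (fun m => ?_) hlim0
    have h := mul_sub_norm_le_of_tendsto_tripNorm hp hsum hya (fun n => hbd _ (hy (k n))) hψ
      ((hg (k m)).comp hk.tendsto_atTop) hc
    rw [hx] at h
    rwa [le_inv_mul_iff₀ hpc]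
  have hiter : ∀ z, Tendsto (fun m => ψ (z + x (k m))) atTop (𝓝 (φ z)) := by
    intro z
    suffices h : Tendsto (fun m => ψ (z + x (k m)) - ‖z + x (k m)‖) atTop (𝓝 0) by
      simpa using h.add (hφ z)
    refine Metric.tendsto_atTop'.2 fun ε hε => ?_
    obtain ⟨c, hc, hzc⟩ := hCd.exists_dist_lt (a⁻¹ • z) (show 0 < ε / (4 * a) by positivity)
    have hzc' : ‖a • c - z‖ < ε / 4 := by
      rw [dist_comm, dist_eq_norm, lt_div_iff₀ (by positivity)] at hzc
      have : a • c - z = a • (c - a⁻¹ • z) := by rw [smul_sub, smul_inv_smul₀ ha0.ne']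
      rw [this, norm_smul, Real.norm_of_nonneg ha0.le]
      linarith
    have h1 : ∀ᶠ m in atTop, ‖‖x (k m)‖ • c - z‖ < ε / 4 :=
      ((ha.smul_const c).sub_const z).norm.eventually_lt_const hzc'
    have h2 := (hdefect c hc).eventually_lt_const (show 0 < ε / 2 by positivity)
    obtain ⟨N, hN⟩ := eventually_atTop.1 (h1.and h2)
    refine ⟨N, fun m hm => ?_⟩
    obtain ⟨h1, h2⟩ := hN m hm.le
    have h3 := abs_le.1 (abs_sub_le_of_tendsto_norm_add hψ
      (‖x (k m)‖ • c + x (k m)) (z + x (k m)))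
    have h4 := abs_le.1 (abs_norm_add_sub_norm_add_le (‖x (k m)‖ • c) z (x (k m)))
    rw [add_sub_add_right_eq_sub] at h3
    rw [dist_zero_right, Real.norm_of_nonneg (sub_nonneg.2 (hle _))]
    linarith [h3.1, h4.2]
  refine ⟨k, hk, a, ha, fun y₀ => ?_⟩
  have hcoef : Tendsto (fun m => a * ‖x (k m)‖⁻¹ - 1) atTop (𝓝 0) := by
    simpa [ha0.ne'] using ((ha.inv₀ ha0.ne').const_mul a).sub_const 1
  have hsmall : Tendsto (fun m => (a * ‖x (k m)‖⁻¹ - 1) • x (k m)) atTop (𝓝 0) := by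
    rw [tendsto_zero_iff_norm_tendsto_zero]
    simpa [norm_smul] using hcoef.abs.mul ha
  have hz : Tendsto (fun m => a • y₀ + (a * ‖x (k m)‖⁻¹ - 1) • x (k m)) atTop (𝓝 (a • y₀)) := by
    simpa using hsmall.const_add (a • y₀)
  have hrw : ∀ m, y₀ + ‖x (k m)‖⁻¹ • x (k m) =
      a⁻¹ • (a • y₀ + (a * ‖x (k m)‖⁻¹ - 1) • x (k m) + x (k m)) := by
    intro m
    rw [add_assoc, sub_smul, one_smul, sub_add_cancel, mul_smul, ← smul_add,
      inv_smul_smul₀ ha0.ne']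
  refine ⟨a⁻¹ * φ (a • y₀), ?_, ?_⟩
  · refine ((tendsto_norm_add_of_tendsto (hφ (a • y₀)) hz).const_mul a⁻¹).congr fun m => ?_
    rw [hrw, norm_smul, Real.norm_of_nonneg (inv_nonneg.2 ha0.le)]
  · refine ⟨fun m => a⁻¹ * ψ (a • y₀ + (a * ‖x (k m)‖⁻¹ - 1) • x (k m) + x (k m)),
      fun m => ?_, Tendsto.const_mul _ ?_⟩
    · refine ((hψ _).const_mul a⁻¹).congr fun n => ?_
      beta_reduce
      rw [hrw, ← smul_add, norm_smul, Real.norm_of_nonneg (inv_nonneg.2 ha0.le)]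
    · have h0 : Tendsto (fun m => ψ (a • y₀ + (a * ‖x (k m)‖⁻¹ - 1) • x (k m) + x (k m)) -
          ψ (a • y₀ + x (k m))) atTop (𝓝 0) := by
        refine squeeze_zero_norm (fun m => ?_) (by simpa using hsmall.norm)
        exact (abs_sub_le_of_tendsto_norm_add hψ _ _).trans_eq (by congr 1; abel)
      simpa using h0.add (hiter (a • y₀))
end

section
/- For every separable infinite-dimensional real Banach space X there exists an equivalent norm ||||·|||| on X with the following property: if there exist ||||·||||-normalized basic sequences (x_m)_{m∈ω} and (y_n)_{n∈ω} in X such that lim_{m→∞} lim_{n→∞} ||||x_m + y_n|||| = 2, then X is not reflexive. -/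
open Filter Finset Topology

variable {X : Type*} [NormedAddCommGroup X] [NormedSpace ℝ X]
variable {E : Type*} [NormedAddCommGroup E] [NormedSpace ℝ E]

/-- `(x i)` is a `C`-basic sequence. -/
def IsCBasic (C : ℝ) (x : ℕ → X) : Prop :=
  (∀ i, x i ≠ 0) ∧
    ∀ n m : ℕ, n < m → ∀ a : ℕ → ℝ,
      ‖∑ i ∈ Finset.range n, a i • x i‖ ≤ C * ‖∑ i ∈ Finset.range m, a i • x i‖

/-- The finite sequence `y 0, …, y (m-1)` is `C`-basic. -/
def IsCBasicUpTo (C : ℝ) (m : ℕ) (y : ℕ → X) : Prop :=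
  (∀ j, j < m → y j ≠ 0) ∧
    ∀ n k : ℕ, n < k → k ≤ m → ∀ a : ℕ → ℝ,
      ‖∑ i ∈ Finset.range n, a i • y i‖ ≤ C * ‖∑ i ∈ Finset.range k, a i • y i‖

/-- `(x i)` is normalized. -/
def Normalized (x : ℕ → X) : Prop := ∀ i, ‖x i‖ = 1

/-- `x` is a `K`-basic array: each row `x n` is a normalized `K`-basic sequence and every
"diagonal" sequence `(x j (i j))_{j<m}` with `m ≤ i 0 < i 1 < ⋯` is `K`-basic. -/
def IsBasicArrayWith (K : ℝ) (x : ℕ → ℕ → X) : Prop :=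
  (∀ n, Normalized (x n) ∧ IsCBasic K (x n)) ∧
    ∀ (m : ℕ) (i : ℕ → ℕ), StrictMono i → m ≤ i 0 →
      IsCBasicUpTo K m fun j => x j (i j)

/-- `x` is a basic array if it is a `K`-basic array for some `K`. -/
def IsBasicArray (x : ℕ → ℕ → X) : Prop := ∃ K : ℝ, IsBasicArrayWith K x

/-- `(x i)` is a `C`-basic sequence with respect to the norm function `ν`. -/
def IsCBasicW (ν : X → ℝ) (C : ℝ) (x : ℕ → X) : Prop :=
  (∀ i, x i ≠ 0) ∧
    ∀ n m : ℕ, n < m → ∀ a : ℕ → ℝ,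
      ν (∑ i ∈ Finset.range n, a i • x i) ≤ C * ν (∑ i ∈ Finset.range m, a i • x i)

/-- The finite sequence `y 0, …, y (m-1)` is `C`-basic with respect to `ν`. -/
def IsCBasicUpToW (ν : X → ℝ) (C : ℝ) (m : ℕ) (y : ℕ → X) : Prop :=
  (∀ j, j < m → y j ≠ 0) ∧
    ∀ n k : ℕ, n < k → k ≤ m → ∀ a : ℕ → ℝ,
      ν (∑ i ∈ Finset.range n, a i • y i) ≤ C * ν (∑ i ∈ Finset.range k, a i • y i)

/-- `(x i)` is normalized with respect to `ν`. -/
def NormalizedW (ν : X → ℝ) (x : ℕ → X) : Prop := ∀ i, ν (x i) = 1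

/-- `x` is a `K`-basic array with respect to `ν`. -/
def IsBasicArrayWithW (ν : X → ℝ) (K : ℝ) (x : ℕ → ℕ → X) : Prop :=
  (∀ n, NormalizedW ν (x n) ∧ IsCBasicW ν K (x n)) ∧
    ∀ (m : ℕ) (i : ℕ → ℕ), StrictMono i → m ≤ i 0 →
      IsCBasicUpToW ν K m fun j => x j (i j)

/-- `x` is a basic array with respect to `ν`. -/
def IsBasicArrayW (ν : X → ℝ) (x : ℕ → ℕ → X) : Prop := ∃ K : ℝ, IsBasicArrayWithW ν K x

/-- An equivalent norm on `X`: a subadditive, absolutely homogeneous functional which is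
equivalent to the original norm. -/
structure EquivNorm (X : Type*) [NormedAddCommGroup X] [NormedSpace ℝ X] where
  toFun : X → ℝ
  add_le' : ∀ x y : X, toFun (x + y) ≤ toFun x + toFun y
  smul' : ∀ (a : ℝ) (x : X), toFun (a • x) = |a| * toFun x
  lower' : ∃ A : ℝ, 0 < A ∧ ∀ x : X, A * ‖x‖ ≤ toFun x
  upper' : ∃ B : ℝ, 0 < B ∧ ∀ x : X, toFun x ≤ B * ‖x‖

/-- A Banach space is reflexive if the canonical inclusion into its double dual is onto. -/
def IsReflexive (Z : Type*) [NormedAddCommGroup Z] [NormedSpace ℝ Z] : Prop :=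
  Function.Surjective ⇑(NormedSpace.inclusionInDoubleDual ℝ Z)

/-- In a reflexive space every bounded sequence converges weakly along an ultrafilter. -/
theorem IsReflexive.exists_forall_tendsto_ultrafilter (hr : IsReflexive X) {u : ℕ → X} {R : ℝ}
    (hu : ∀ i, ‖u i‖ ≤ R) (U : Ultrafilter ℕ) :
    ∃ z : X, ∀ f : StrongDual ℝ X, Tendsto (fun i => f (u i)) U (𝓝 (f z)) := by
  let J : ℕ → WeakDual ℝ (StrongDual ℝ X) := fun i =>
    StrongDual.toWeakDual (NormedSpace.inclusionInDoubleDual ℝ X (u i))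
  have hc := WeakDual.isCompact_closedBall (𝕜 := ℝ) (E := StrongDual ℝ X) 0 R
  obtain ⟨ψ, -, hψ⟩ := hc.ultrafilter_le_nhds (U.map J) (by
    rw [Ultrafilter.coe_map, le_principal_iff, Filter.mem_map]
    refine univ_mem' fun i => ?_
    change NormedSpace.inclusionInDoubleDual ℝ X (u i) ∈ Metric.closedBall 0 R
    exact (mem_closedBall_zero_iff (E := StrongDual ℝ (StrongDual ℝ X))).2
      ((NormedSpace.double_dual_bound ℝ X (u i)).trans (hu i)))
  obtain ⟨z, hz⟩ := hr (WeakDual.toStrongDual ψ)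
  refine ⟨z, fun f => ?_⟩
  have h : Tendsto (fun i => J i f) U (𝓝 (ψ f)) :=
    ((WeakDual.eval_continuous f).tendsto ψ).comp hψ
  have h' : ψ f = f z := by
    change WeakDual.toStrongDual ψ f = f z
    rw [← hz, NormedSpace.dual_def]
  rwa [h'] at h

theorem IsCBasic.norm_le_of_mem_span {C : ℝ} {u : ℕ → X} (hb : IsCBasic C u) {n : ℕ} {w w' : X}
    (hw : w ∈ Submodule.span ℝ (u '' Set.Iio n)) (hw' : w' ∈ Submodule.span ℝ (u '' Set.Ici n)) :
    ‖w‖ ≤ C * ‖w - w'‖ := by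
  obtain ⟨l, hl, rfl⟩ := (Finsupp.mem_span_image_iff_linearCombination ℝ).1 hw
  obtain ⟨l', hl', rfl⟩ := (Finsupp.mem_span_image_iff_linearCombination ℝ).1 hw'
  rw [Finsupp.mem_supported'] at hl hl'
  set m := (l - l').support.sup id + n + 1 with hm
  have h := hb.2 n m (by omega) ⇑(l - l')
  have h1 : ∑ i ∈ Finset.range n, (l - l') i • u i = Finsupp.linearCombination ℝ u l := by
    rw [Finsupp.linearCombination_apply, Finsupp.sum_of_support_subset l (s := Finset.range n) _ _
      (by simp)]
    · refine Finset.sum_congr rfl fun i hi => ?_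
      rw [Finsupp.sub_apply, hl' i (by simpa using hi), sub_zero]
    · intro i hi
      by_contra hin
      exact Finsupp.mem_support_iff.1 hi (hl i (by simpa using hin))
  have h2 : ∑ i ∈ Finset.range m, (l - l') i • u i = Finsupp.linearCombination ℝ u (l - l') := by
    rw [Finsupp.linearCombination_apply,
      Finsupp.sum_of_support_subset (l - l') (s := Finset.range m) _ _ (by simp)]
    intro i hi
    have := Finset.le_sup (f := id) hi
    simp only [id] at this
    rw [Finset.mem_range]
    omega
  rwa [h1, h2, map_sub] at h

theorem exists_mem_span_image_Iio {u : ℕ → X} {w : X} (hw : w ∈ Submodule.span ℝ (Set.range u)) :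
    ∃ n, w ∈ Submodule.span ℝ (u '' Set.Iio n) := by
  rw [← Set.image_univ] at hw
  obtain ⟨l, -, rfl⟩ := (Finsupp.mem_span_image_iff_linearCombination ℝ).1 hw
  refine ⟨l.support.sup id + 1, (Finsupp.mem_span_image_iff_linearCombination ℝ).2 ⟨l, ?_, rfl⟩⟩
  rw [Finsupp.mem_supported]
  intro i hi
  have := Finset.le_sup (f := id) hi
  simp only [id] at this
  rw [Set.mem_Iio]
  omega

/-- In a reflexive space, `0` is in the closed convex hull of every subsequence of a bounded
basic sequence. -/
theorem IsCBasic.exists_mem_convexHull_norm_lt (hr : IsReflexive X) {C R : ℝ} {u : ℕ → X}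
    (hb : IsCBasic C u) (hu : ∀ i, ‖u i‖ ≤ R) {A : Set ℕ} (hA : A.Infinite) {ε : ℝ} (hε : 0 < ε) :
    ∃ w ∈ convexHull ℝ (u '' A), ‖w‖ < ε := by
  have : (cofinite ⊓ 𝓟 A).NeBot := hA.cofinite_inf_principal_neBot
  set U : Ultrafilter ℕ := Ultrafilter.of (cofinite ⊓ 𝓟 A)
  have hU : (U : Filter ℕ) ≤ cofinite ⊓ 𝓟 A := Ultrafilter.of_le _
  obtain ⟨z, hz⟩ := hr.exists_forall_tendsto_ultrafilter hu U
  have hmem : ∀ n, z ∈ closure (convexHull ℝ (u '' (A ∩ Set.Ici n))) := by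
    intro n
    by_contra hn
    obtain ⟨f, r, hfz, hf⟩ :=
      geometric_hahn_banach_point_closed (convex_convexHull ℝ _).closure isClosed_closure hn
    have h1 : ∀ᶠ i in (U : Filter ℕ), f (u i) < r := (hz f).eventually_lt_const hfz
    have h2 : ∀ᶠ i in (U : Filter ℕ), i ∈ A := hU (mem_inf_of_right (mem_principal_self A))
    have h3 : ∀ᶠ i in (U : Filter ℕ), n ≤ i := by
      refine hU (mem_inf_of_left ?_)
      rw [Nat.cofinite_eq_atTop]
      exact eventually_ge_atTop n
    obtain ⟨i, hi1, hi2, hi3⟩ := (h1.and (h2.and h3)).exists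
    exact (hf _ (subset_closure (subset_convexHull ℝ _ ⟨i, ⟨hi2, hi3⟩, rfl⟩))).not_gt hi1
  have hδ : 0 < ε / (2 * (|C| + 1)) := by positivity
  obtain ⟨w, hw, hwz⟩ := Metric.mem_closure_iff.1 (hmem 0) _ hδ
  obtain ⟨n, hn⟩ := exists_mem_span_image_Iio (u := u) (w := w)
    (convexHull_min ((Set.image_subset_range _ _).trans Submodule.subset_span)
      (Submodule.convex _) hw)
  obtain ⟨w', hw', hwz'⟩ := Metric.mem_closure_iff.1 (hmem n) _ hδ
  have hn' : w' ∈ Submodule.span ℝ (u '' Set.Ici n) :=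
    convexHull_min ((Set.image_mono Set.inter_subset_right).trans Submodule.subset_span)
      (Submodule.convex _) hw'
  refine ⟨w, convexHull_mono (Set.image_mono Set.inter_subset_left) hw, ?_⟩
  have hd : ‖w - w'‖ ≤ ε / (|C| + 1) := by
    rw [← dist_eq_norm]
    calc dist w w' ≤ dist z w + dist z w' := dist_triangle_left _ _ _
      _ ≤ ε / (2 * (|C| + 1)) + ε / (2 * (|C| + 1)) := by linarith
      _ = ε / (|C| + 1) := by field_simp; ring
  calc ‖w‖ ≤ C * ‖w - w'‖ := hb.norm_le_of_mem_span hn hn'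
    _ ≤ |C| * (ε / (|C| + 1)) := mul_le_mul (le_abs_self C) hd (norm_nonneg _) (abs_nonneg C)
    _ < ε := by
      rw [mul_div_assoc', div_lt_iff₀ (by positivity)]
      nlinarith

theorem Ultrafilter.exists_tendsto_of_bounded {ι : Type*} (U : Ultrafilter ι) {f : ι → ℝ} {B : ℝ}
    (hf : ∀ i, |f i| ≤ B) : ∃ l, Tendsto f U (𝓝 l) := by
  obtain ⟨l, -, hl⟩ := (isCompact_Icc (a := -B) (b := B)).ultrafilter_le_nhds (U.map f) (by
    rw [Ultrafilter.coe_map, le_principal_iff, Filter.mem_map]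
    exact univ_mem' fun i => abs_le.1 (hf i))
  exact ⟨l, hl⟩

/-- The defect in the triangle inequality for a pair of vectors. -/
def triangleDefect (p q : X) : ℝ := ‖p‖ + ‖q‖ - ‖p + q‖

omit [NormedSpace ℝ X] in
theorem triangleDefect_nonneg (p q : X) : 0 ≤ triangleDefect p q :=
  sub_nonneg.2 (norm_add_le p q)

theorem triangleDefect_smul_le {s t K : ℝ} (hs : 0 ≤ s) (ht : 0 ≤ t) (hsK : s ≤ K) (htK : t ≤ K)
    (p q : X) : triangleDefect (s • p) (t • q) ≤ K * triangleDefect p q := by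
  have hK : 0 ≤ K := hs.trans hsK
  have h : K * ‖p + q‖ ≤ ‖s • p + t • q‖ + (K - s) * ‖p‖ + (K - t) * ‖q‖ := by
    calc K * ‖p + q‖ = ‖K • (p + q)‖ := by rw [norm_smul, Real.norm_of_nonneg hK]
      _ = ‖(s • p + t • q) + (K - s) • p + (K - t) • q‖ := by congr 1; module
      _ ≤ ‖s • p + t • q‖ + ‖(K - s) • p‖ + ‖(K - t) • q‖ := norm_add₃_le
      _ = _ := by
        rw [norm_smul, norm_smul, Real.norm_of_nonneg (sub_nonneg.2 hsK),
          Real.norm_of_nonneg (sub_nonneg.2 htK)]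
  simp only [triangleDefect, norm_smul, Real.norm_of_nonneg hs, Real.norm_of_nonneg ht]
  linarith

omit [NormedSpace ℝ X] in
theorem abs_triangleDefect_sub_le (p q p' q' : X) :
    |triangleDefect p q - triangleDefect p' q'| ≤ 2 * (‖p - p'‖ + ‖q - q'‖) := by
  have h1 := abs_norm_sub_norm_le p p'
  have h2 := abs_norm_sub_norm_le q q'
  have h3 := (abs_norm_sub_norm_le (p + q) (p' + q')).trans
    ((congrArg norm (add_sub_add_comm p q p' q')).le.trans (norm_add_le _ _))
  rw [abs_le] at *
  simp only [triangleDefect]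
  constructor <;> linarith [h1.1, h1.2, h2.1, h2.2, h3.1, h3.2]

/-- The symmetrised norm of `x` translated by `‖x‖ • c`. -/
def translateNorm (c x : X) : ℝ := ‖‖x‖ • c + x‖ + ‖‖x‖ • c - x‖

theorem norm_smul_add_add_norm_smul_sub_mono_s16 (c z : X) {r t : ℝ} (hr : 0 ≤ r) (hrt : r ≤ t) :
    ‖r • c + z‖ + ‖r • c - z‖ ≤ ‖t • c + z‖ + ‖t • c - z‖ := by
  rcases hr.eq_or_lt with rfl | hr
  · have := norm_sub_le (t • c + z) (t • c - z)
    rw [show t • c + z - (t • c - z) = (2 : ℝ) • z by module, norm_smul] at this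
    simp only [zero_smul, zero_add, zero_sub, norm_neg]
    norm_num at this
    linarith
  · have ht : 0 < t := hr.trans_le hrt
    set l : ℝ := (1 + r / t) / 2
    have hl : r = l * t - (1 - l) * t := by simp only [l]; field_simp; ring
    have h0 : 0 ≤ l := by positivity
    have h1 : 0 ≤ 1 - l := by
      have : r / t ≤ 1 := (div_le_one ht).2 hrt
      simp only [l]; linarith
    have e1 : ‖r • c + z‖ ≤ l * ‖t • c + z‖ + (1 - l) * ‖t • c - z‖ := by
      have : r • c + z = l • (t • c + z) - (1 - l) • (t • c - z) := by rw [hl]; module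
      rw [this]
      refine (norm_sub_le _ _).trans_eq ?_
      rw [norm_smul, norm_smul, Real.norm_of_nonneg h0, Real.norm_of_nonneg h1]
    have e2 : ‖r • c - z‖ ≤ l * ‖t • c - z‖ + (1 - l) * ‖t • c + z‖ := by
      have : r • c - z = l • (t • c - z) - (1 - l) • (t • c + z) := by rw [hl]; module
      rw [this]
      refine (norm_sub_le _ _).trans_eq ?_
      rw [norm_smul, norm_smul, Real.norm_of_nonneg h0, Real.norm_of_nonneg h1]
    linarith

theorem translateNorm_nonneg (c x : X) : 0 ≤ translateNorm c x := by
  unfold translateNorm; positivity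

theorem translateNorm_add_le (c x y : X) :
    translateNorm c (x + y) ≤ translateNorm c x + translateNorm c y := by
  have h := norm_smul_add_add_norm_smul_sub_mono_s16 c (x + y) (norm_nonneg _) (norm_add_le x y)
  have h1 : ‖(‖x‖ + ‖y‖) • c + (x + y)‖ ≤ ‖‖x‖ • c + x‖ + ‖‖y‖ • c + y‖ := by
    rw [show (‖x‖ + ‖y‖) • c + (x + y) = (‖x‖ • c + x) + (‖y‖ • c + y) by module]
    exact norm_add_le _ _
  have h2 : ‖(‖x‖ + ‖y‖) • c - (x + y)‖ ≤ ‖‖x‖ • c - x‖ + ‖‖y‖ • c - y‖ := by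
    rw [show (‖x‖ + ‖y‖) • c - (x + y) = (‖x‖ • c - x) + (‖y‖ • c - y) by module]
    exact norm_add_le _ _
  unfold translateNorm
  linarith

theorem translateNorm_smul (c : X) (a : ℝ) (x : X) :
    translateNorm c (a • x) = |a| * translateNorm c x := by
  have h (b : ℝ) (hb : 0 ≤ b) : translateNorm c (b • x) = b * translateNorm c x := by
    simp only [translateNorm, norm_smul, Real.norm_of_nonneg hb, mul_smul]
    rw [← smul_add, ← smul_sub, norm_smul, norm_smul, Real.norm_of_nonneg hb, mul_add]
  have hneg (z : X) : translateNorm c (-z) = translateNorm c z := by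
    simp only [translateNorm, norm_neg, ← sub_eq_add_neg, sub_neg_eq_add]
    exact add_comm _ _
  rcases abs_cases a with ⟨ha, ha'⟩ | ⟨ha, ha'⟩
  · rw [ha, h a ha']
  · rw [ha, ← h (-a) (by linarith), neg_smul, hneg]

theorem translateNorm_le (c x : X) : translateNorm c x ≤ 2 * (1 + ‖c‖) * ‖x‖ := by
  have h1 := norm_add_le (‖x‖ • c) x
  have h2 := norm_sub_le (‖x‖ • c) x
  rw [norm_smul, norm_norm] at h1 h2
  unfold translateNorm
  linarith

theorem abs_translateNorm_sub_le (c x : X) (r : ℝ) :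
    |translateNorm c x - (‖r • c + x‖ + ‖r • c - x‖)| ≤ 2 * ‖c‖ * |‖x‖ - r| := by
  have h1 := abs_norm_sub_norm_le (‖x‖ • c + x) (r • c + x)
  have h2 := abs_norm_sub_norm_le (‖x‖ • c - x) (r • c - x)
  rw [show ‖x‖ • c + x - (r • c + x) = (‖x‖ - r) • c by module, norm_smul, Real.norm_eq_abs] at h1
  rw [show ‖x‖ • c - x - (r • c - x) = (‖x‖ - r) • c by module, norm_smul, Real.norm_eq_abs] at h2
  unfold translateNorm
  rw [abs_le] at *
  constructor <;> linarith [h1.1, h1.2, h2.1, h2.2]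

/-- The weight of the `k`-th seminorm in `renorm`. -/
noncomputable def renormWeight (c : ℕ → X) (k : ℕ) : ℝ := (1 / 2) ^ k / (1 + ‖c k‖)

omit [NormedSpace ℝ X] in
theorem renormWeight_pos (c : ℕ → X) (k : ℕ) : 0 < renormWeight c k := by
  unfold renormWeight; positivity

theorem renormWeight_mul_translateNorm_le (c : ℕ → X) (k : ℕ) (x : X) :
    renormWeight c k * translateNorm (c k) x ≤ (1 / 2) ^ k * (2 * ‖x‖) := by
  refine (mul_le_mul_of_nonneg_left (translateNorm_le (c k) x)
    (renormWeight_pos c k).le).trans_eq ?_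
  have : 1 + ‖c k‖ ≠ 0 := by positivity
  unfold renormWeight
  field_simp

theorem summable_renormWeight_mul_translateNorm (c : ℕ → X) (x : X) :
    Summable fun k => renormWeight c k * translateNorm (c k) x :=
  .of_nonneg_of_le (fun k => mul_nonneg (renormWeight_pos c k).le (translateNorm_nonneg _ _))
    (fun k => renormWeight_mul_translateNorm_le c k x) (summable_geometric_two.mul_right _)

/-- The Odell–Schlumprecht renorming associated with a sequence of translates. -/
noncomputable def renorm (c : ℕ → X) : EquivNorm X where
  toFun x := ‖x‖ + ∑' k, renormWeight c k * translateNorm (c k) x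
  add_le' x y := by
    have hx := summable_renormWeight_mul_translateNorm c x
    have hy := summable_renormWeight_mul_translateNorm c y
    have h := (summable_renormWeight_mul_translateNorm c (x + y)).tsum_le_tsum
      (fun k => (mul_le_mul_of_nonneg_left (translateNorm_add_le (c k) x y)
        (renormWeight_pos c k).le).trans_eq (mul_add _ _ _)) (hx.add hy)
    rw [hx.tsum_add hy] at h
    linarith [norm_add_le x y]
  smul' a x := by
    simp only [translateNorm_smul, norm_smul, Real.norm_eq_abs, mul_add, ← tsum_mul_left]
    congr 2 with k
    ring
  lower' := ⟨1, one_pos, fun x => by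
    rw [one_mul]
    exact le_add_of_nonneg_right (tsum_nonneg fun k =>
      mul_nonneg (renormWeight_pos c k).le (translateNorm_nonneg _ _))⟩
  upper' := ⟨5, by norm_num, fun x => by
    have h := (summable_renormWeight_mul_translateNorm c x).tsum_le_tsum
      (fun k => renormWeight_mul_translateNorm_le c k x) (summable_geometric_two.mul_right _)
    rw [tsum_mul_right, tsum_geometric_two] at h
    linarith⟩

theorem renorm_defect (c : ℕ → X) (x y : X) :
    triangleDefect x y ≤ (renorm c).toFun x + (renorm c).toFun y - (renorm c).toFun (x + y) ∧
    ∀ k, renormWeight c k *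
      (translateNorm (c k) x + translateNorm (c k) y - translateNorm (c k) (x + y)) ≤
        (renorm c).toFun x + (renorm c).toFun y - (renorm c).toFun (x + y) := by
  set d : ℕ → ℝ := fun k => renormWeight c k *
      (translateNorm (c k) x + translateNorm (c k) y - translateNorm (c k) (x + y)) with hd
  have hd0 k : 0 ≤ d k := mul_nonneg (renormWeight_pos c k).le
    (sub_nonneg.2 (translateNorm_add_le _ _ _))
  have hs : HasSum d ((∑' k, renormWeight c k * translateNorm (c k) x) +
      (∑' k, renormWeight c k * translateNorm (c k) y) -
      ∑' k, renormWeight c k * translateNorm (c k) (x + y)) := by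
    have h z := (summable_renormWeight_mul_translateNorm c z).hasSum
    have he : d = fun k => renormWeight c k * translateNorm (c k) x +
        renormWeight c k * translateNorm (c k) y - renormWeight c k * translateNorm (c k) (x + y) :=
      funext fun k => by simp only [hd]; ring
    rw [he]
    exact ((h x).add (h y)).sub (h (x + y))
  have htot : (renorm c).toFun x + (renorm c).toFun y - (renorm c).toFun (x + y) =
      triangleDefect x y + ∑' k, d k := by
    rw [hs.tsum_eq]
    simp only [renorm, triangleDefect]
    ring
  rw [htot]
  refine ⟨le_add_of_nonneg_right (tsum_nonneg hd0), fun k => ?_⟩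
  have := hs.summable.le_tsum k fun j _ => hd0 j
  linarith [triangleDefect_nonneg x y]

theorem tendsto_triangleDefect_of_translateNorm {ι : Type*} {l : Filter ι} {p q : ι → X}
    {a b : ℝ} (hp : Tendsto (fun i => ‖p i‖) l (𝓝 a)) (hq : Tendsto (fun i => ‖q i‖) l (𝓝 b))
    (hpq : Tendsto (fun i => triangleDefect (p i) (q i)) l (𝓝 0)) {c : X}
    (hc : Tendsto (fun i => translateNorm c (p i) + translateNorm c (q i) -
      translateNorm c (p i + q i)) l (𝓝 0)) :
    Tendsto (fun i => triangleDefect (a • c + p i) (b • c + q i)) l (𝓝 0) := by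
  have hs : Tendsto (fun i => ‖p i + q i‖) l (𝓝 (a + b)) := by
    simpa [triangleDefect] using (hp.add hq).sub hpq
  have key (f : ι → X) (r : ℝ) (h : Tendsto (fun i => ‖f i‖) l (𝓝 r)) :
      Tendsto (fun i => 2 * ‖c‖ * |‖f i‖ - r|) l (𝓝 0) := by
    simpa using ((h.sub_const r).abs).const_mul (2 * ‖c‖)
  have hlim := ((hc.add (key p a hp)).add (key q b hq)).add (key (fun i => p i + q i) (a + b) hs)
  simp only [add_zero] at hlim
  refine squeeze_zero (fun i => triangleDefect_nonneg _ _) (fun i => ?_) hlim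
  have h1 := abs_le.1 (abs_translateNorm_sub_le c (p i) a)
  have h2 := abs_le.1 (abs_translateNorm_sub_le c (q i) b)
  have h3 := abs_le.1 (abs_translateNorm_sub_le c (p i + q i) (a + b))
  have h4 := triangleDefect_nonneg (a • c - p i) (b • c - q i)
  unfold triangleDefect at h4 ⊢
  rw [show a • c - p i + (b • c - q i) = (a + b) • c - (p i + q i) by module] at h4
  rw [show a • c + p i + (b • c + q i) = (a + b) • c + (p i + q i) by module]
  linarith [h1.1, h1.2, h2.1, h2.2, h3.1, h3.2]

theorem tendsto_triangleDefect_of_denseRange {ι κ : Type*} {l : Filter ι} {p q : ι → X}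
    {a b : ℝ} {c : κ → X} (hc : DenseRange c)
    (h : ∀ k, Tendsto (fun i => triangleDefect (a • c k + p i) (b • c k + q i)) l (𝓝 0)) (d : X) :
    Tendsto (fun i => triangleDefect (a • d + p i) (b • d + q i)) l (𝓝 0) := by
  rw [Metric.tendsto_nhds]
  intro ε hε
  have hK : 0 < 2 * (|a| + |b|) + 1 := by positivity
  obtain ⟨k, hk⟩ := hc.exists_dist_lt d (ε := ε / 2 / (2 * (|a| + |b|) + 1)) (by positivity)
  rw [lt_div_iff₀ hK, dist_eq_norm] at hk
  filter_upwards [Metric.tendsto_nhds.1 (h k) (ε / 2) (by positivity)] with i hi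
  rw [Real.dist_eq, sub_zero, abs_lt] at hi ⊢
  have h1 := abs_triangleDefect_sub_le (a • d + p i) (b • d + q i) (a • c k + p i) (b • c k + q i)
  rw [show a • d + p i - (a • c k + p i) = a • (d - c k) by module,
    show b • d + q i - (b • c k + q i) = b • (d - c k) by module, norm_smul, norm_smul,
    Real.norm_eq_abs, Real.norm_eq_abs, abs_le] at h1
  have := norm_nonneg (d - c k)
  constructor <;> linarith [h1.1, h1.2, hi.1, hi.2]

theorem tendsto_triangleDefect_smul {ι : Type*} {l : Filter ι} {p q : ι → X}
    (h : Tendsto (fun i => triangleDefect (p i) (q i)) l (𝓝 0)) {s t : ℝ} (hs : 0 ≤ s)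
    (ht : 0 ≤ t) : Tendsto (fun i => triangleDefect (s • p i) (t • q i)) l (𝓝 0) := by
  refine squeeze_zero (fun i => triangleDefect_nonneg _ _) (fun i => triangleDefect_smul_le hs ht
    (le_max_left s t) (le_max_right s t) _ _) ?_
  simpa using h.const_mul (max s t)

/-- Convex functions in such a relation have a common subgradient at every point, so they differ
by a constant; this is one of the two inequalities. -/
theorem sub_le_sub_of_forall_add_le {α β : X → ℝ} (hβ : ∀ x y, |β x - β y| ≤ ‖x - y‖)
    (h : ∀ S M S' : X, S + S' = (2 : ℝ) • M → α M + β M ≤ α S + β S') (c d : X) :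
    α d - α c ≤ β d - β c := by
  have key (N : ℕ) : α d - α c - (β d - β c) ≤ 2 * ‖d - c‖ / ((N : ℝ) + 1) := by
    have hN : (N : ℝ) + 1 ≠ 0 := by positivity
    set z : ℕ → X := fun i => c + ((i : ℝ) / (N + 1)) • (d - c) with hz
    have hsum : ∑ i ∈ Finset.range (N + 1), (α (z (i + 1)) - α (z i)) ≤
        ∑ i ∈ Finset.range (N + 1), (β (z (i + 1 + 1)) - β (z (i + 1))) := by
      refine Finset.sum_le_sum fun i _ => ?_
      have := h (z i) (z (i + 1)) (z (i + 1 + 1)) (by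
        simp only [hz]
        push_cast
        module)
      linarith
    rw [Finset.sum_range_sub (fun i => α (z i)),
      Finset.sum_range_sub (fun i => β (z (i + 1)))] at hsum
    have h0 : z 0 = c := by simp [hz]
    have h1 : z (N + 1) = d := by simp [hz, div_self hN]
    have h2 := (hβ (z (N + 1 + 1)) d)
    have h3 := (hβ (z (0 + 1)) c)
    have e2 : ‖z (N + 1 + 1) - d‖ = ‖d - c‖ / (N + 1) := by
      rw [← h1, show z (N + 1 + 1) - z (N + 1) = (1 / ((N : ℝ) + 1)) • (d - c) by
        simp only [hz]; push_cast; module, norm_smul, Real.norm_of_nonneg (by positivity)]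
      rw [h1]; ring
    have e3 : ‖z (0 + 1) - c‖ = ‖d - c‖ / (N + 1) := by
      rw [show z (0 + 1) - c = (1 / ((N : ℝ) + 1)) • (d - c) by
        simp only [hz]; push_cast; module, norm_smul, Real.norm_of_nonneg (by positivity)]
      ring
    rw [e2, abs_le] at h2
    rw [e3, abs_le] at h3
    rw [h0, h1] at hsum
    rw [show 2 * ‖d - c‖ / ((N : ℝ) + 1) = ‖d - c‖ / (N + 1) + ‖d - c‖ / (N + 1) by ring]
    linarith [h2.2, h3.1]
  have hlim : Tendsto (fun N : ℕ => 2 * ‖d - c‖ / ((N : ℝ) + 1)) atTop (𝓝 0) := by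
    simpa [div_eq_mul_inv] using
      (tendsto_one_div_add_atTop_nhds_zero_nat (𝕜 := ℝ)).const_mul (2 * ‖d - c‖)
  linarith [ge_of_tendsto' hlim key]

theorem Filter.Tendsto.curry_fst {α β γ : Type*} {f : α → γ} {l : Filter α} {l' : Filter β}
    {m : Filter γ} (h : Tendsto f l m) : Tendsto (fun p : α × β => f p.1) (l.curry l') m :=
  h.comp (tendsto_fst.mono_left curry_le_prod)

theorem Filter.Tendsto.curry_snd {α β γ : Type*} {f : β → γ} {l : Filter α} {l' : Filter β}
    {m : Filter γ} (h : Tendsto f l' m) : Tendsto (fun p : α × β => f p.2) (l.curry l') m :=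
  h.comp (tendsto_snd.mono_left curry_le_prod)

/-- Sequences of norm tending to one such that all their pairs of common translates
asymptotically add up isometrically generate the same type, and this type satisfies a functional
equation. -/
theorem exists_type_of_tendsto_triangleDefect (U : Ultrafilter ℕ) {u v : ℕ → X} {R : ℝ}
    (hu : ∀ n, ‖u n‖ ≤ R) (hv : ∀ n, ‖v n‖ ≤ R) (hu1 : Tendsto (fun n => ‖u n‖) U (𝓝 1))
    (hv1 : Tendsto (fun n => ‖v n‖) U (𝓝 1))
    (h : ∀ c, Tendsto (fun p : ℕ × ℕ => triangleDefect (u p.1 + c) (v p.2 + c))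
      ((U : Filter ℕ).curry U) (𝓝 0)) :
    ∃ G : ℝ → X → ℝ, G 1 0 = 1 ∧ (∀ t S, Tendsto (fun n => ‖t • v n + S‖) U (𝓝 (G t S))) ∧
      ∀ s t S, 0 ≤ s → 0 ≤ t → ∀ ε > 0, ∀ᶠ m in (U : Filter ℕ),
        G (s + t) S - ε ≤ G t (S + s • u m) := by
  have hne : ((U : Filter ℕ).curry (U : Filter ℕ)).NeBot :=
    ⟨fun h0 => U.neBot.ne (by simpa using mem_curry_iff.1 (empty_mem_iff_bot.2 h0))⟩
  have hex (w : ℕ → X) (hw : ∀ n, ‖w n‖ ≤ R) (t : ℝ) (S : X) :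
      ∃ r, Tendsto (fun n => ‖t • w n + S‖) U (𝓝 r) := by
    refine U.exists_tendsto_of_bounded (B := |t| * R + ‖S‖) fun n => ?_
    rw [abs_norm]
    refine (norm_add_le _ _).trans ?_
    rw [norm_smul, Real.norm_eq_abs]
    have := mul_le_mul_of_nonneg_left (hw n) (abs_nonneg t)
    linarith
  choose G hG using hex v hv
  have hexu (c : X) : ∃ r, Tendsto (fun n => ‖u n + c‖) U (𝓝 r) := by simpa using hex u hu 1 c
  have hexv (c : X) : ∃ r, Tendsto (fun n => ‖v n + c‖) U (𝓝 r) := by simpa using hex v hv 1 c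
  choose α hα using hexu
  choose β hβ using hexv
  have lip (w : ℕ → X) (γ : X → ℝ) (hγ : ∀ c, Tendsto (fun n => ‖w n + c‖) U (𝓝 (γ c))) (x y : X) :
      |γ x - γ y| ≤ ‖x - y‖ :=
    le_of_tendsto ((hγ x).sub (hγ y)).abs (Eventually.of_forall fun n => by
      simpa using abs_norm_sub_norm_le (w n + x) (w n + y))
  have hmid (S M S' : X) (hS : S + S' = (2 : ℝ) • M) : α M + β M ≤ α S + β S' := by
    have h1 := ((hα M).curry_fst.add (hβ M).curry_snd).sub (h M)
    rw [sub_zero] at h1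
    refine le_of_tendsto_of_tendsto' h1 ((hα S).curry_fst.add (hβ S').curry_snd) fun p => ?_
    simp only [triangleDefect, sub_sub_cancel]
    rw [show u p.1 + M + (v p.2 + M) = u p.1 + v p.2 + (2 : ℝ) • M by module, ← hS,
      show u p.1 + v p.2 + (S + S') = u p.1 + S + (v p.2 + S') by module]
    exact norm_add_le _ _
  have hα0 : α 0 = 1 := tendsto_nhds_unique (hα 0) (by simpa using hu1)
  have hβ0 : β 0 = 1 := tendsto_nhds_unique (hβ 0) (by simpa using hv1)
  have hαβ (c : X) : α c = β c := by
    have h1 := sub_le_sub_of_forall_add_le (lip v β hβ) hmid 0 c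
    have h2 := sub_le_sub_of_forall_add_le (lip u α hα) (α := β) (fun S M S' hS => by
      have := hmid S' M S (by rw [← hS, add_comm])
      linarith) 0 c
    linarith
  refine ⟨G, tendsto_nhds_unique (hG 1 0) (by simpa using hv1), hG, fun s t S hs ht ε hε => ?_⟩
  have hlim : Tendsto (fun p : ℕ × ℕ => ‖t • v p.2 + (S + s • u p.1)‖)
      ((U : Filter ℕ).curry U) (𝓝 (G (s + t) S)) := by
    rcases (add_nonneg hs ht).eq_or_lt with h0 | hpos
    · obtain rfl : s = 0 := by linarith
      obtain rfl : t = 0 := by linarith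
      simpa using (hG (0 + 0) S).curry_snd (l := (U : Filter ℕ))
    · set c : X := (s + t)⁻¹ • S with hc
      have hcS : S = (s + t) • c := by rw [hc, smul_inv_smul₀ hpos.ne']
      have hGc : G (s + t) S = (s + t) * β c := by
        refine tendsto_nhds_unique (hG (s + t) S) ?_
        convert (hβ c).const_mul (s + t) using 2 with n
        rw [hcS, ← smul_add, norm_smul, Real.norm_of_nonneg hpos.le]
      have h1 := (((hα c).curry_fst.const_mul s).add ((hβ c).curry_snd.const_mul t)).sub
        (tendsto_triangleDefect_smul (h c) hs ht)
      rw [hαβ, ← add_mul, sub_zero, ← hGc] at h1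
      convert h1 using 2 with p
      simp only [triangleDefect, norm_smul, Real.norm_of_nonneg hs, Real.norm_of_nonneg ht,
        sub_sub_cancel]
      congr 1
      rw [hcS]
      module
  have hev := hlim.eventually_const_lt (sub_lt_self (G (s + t) S) hε)
  rw [eventually_curry_iff] at hev
  filter_upwards [hev] with m hm
  exact ge_of_tendsto (hG t (S + s • u m)) (hm.mono fun n hn => hn.le)

/-- One step of the construction of a subsequence generating a positive cone isomorphic to that
of `ℓ₁`. -/
theorem eventually_forall_mem_convexHull_insert {l : Filter ℕ} {u : ℕ → X} {R : ℝ}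
    (hu : ∀ n, ‖u n‖ ≤ R) {G : ℝ → X → ℝ}
    (hlip : ∀ t t' S S', |G t S - G t' S'| ≤ R * |t - t'| + ‖S - S'‖)
    (hG : ∀ s t S, 0 ≤ s → 0 ≤ t → ∀ ε > 0, ∀ᶠ m in l, G (s + t) S - ε ≤ G t (S + s • u m))
    {F : Set (ℝ × X)} (hF : F.Finite) (h1 : ((1 : ℝ), (0 : X)) ∈ F) (h0 : ∀ p ∈ F, 0 ≤ p.1)
    {η : ℝ} (hη : ∀ p ∈ convexHull ℝ F, η ≤ G p.1 p.2) {ε : ℝ} (hε : 0 < ε) :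
    ∀ᶠ m in l, ∀ p ∈ convexHull ℝ (insert ((0 : ℝ), u m) F), η - ε ≤ G p.1 p.2 := by
  have hK : IsCompact (Set.Icc (0 : ℝ) 1 ×ˢ convexHull ℝ F) :=
    isCompact_Icc.prod (hF.isCompact_convexHull ℝ)
  have hpos : ∀ p ∈ convexHull ℝ F, 0 ≤ p.1 :=
    convexHull_min (t := {p : ℝ × X | 0 ≤ p.1}) h0 (convex_halfSpace_ge (f := Prod.fst)
      (LinearMap.fst ℝ ℝ X).isLinear 0)
  have key : ∀ᶠ m in l, ∀ z ∈ Set.Icc (0 : ℝ) 1 ×ˢ convexHull ℝ F,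
      η - ε ≤ G ((1 - z.1) * z.2.1) ((1 - z.1) • z.2.2 + z.1 • u m) := by
    refine hK.induction_on (p := fun s => ∀ᶠ m in l, ∀ z ∈ s,
      η - ε ≤ G ((1 - z.1) * z.2.1) ((1 - z.1) • z.2.2 + z.1 • u m)) (by simp)
      (fun s t hst ht => ht.mono fun m hm z hz => hm z (hst hz))
      (fun s t hs ht => (hs.and ht).mono fun m hm z hz => hz.elim (hm.1 z) (hm.2 z)) ?_
    rintro ⟨s, t, S⟩ ⟨hs, hp⟩
    let e : ℝ × ℝ × X → ℝ := fun z => R * |(1 - z.1) * z.2.1 - (1 - s) * t| +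
      (‖(1 - z.1) • z.2.2 - (1 - s) • S‖ + |z.1 - s| * R)
    have he : Continuous e := by fun_prop
    have he0 : e (s, t, S) = 0 := by simp [e]
    refine ⟨{z | e z < ε / 2}, mem_nhdsWithin_of_mem_nhds
      ((isOpen_lt he continuous_const).mem_nhds (by simpa [he0] using hε)), ?_⟩
    filter_upwards [hG s ((1 - s) * t) ((1 - s) • S) hs.1
      (mul_nonneg (sub_nonneg.2 hs.2) (hpos _ hp)) (ε / 2) (half_pos hε)] with m hm z hz
    have hmem : (s + (1 - s) * t, (1 - s) • S) ∈ convexHull ℝ F := by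
      have := convex_convexHull ℝ F (subset_convexHull ℝ F h1) hp hs.1 (sub_nonneg.2 hs.2)
        (add_sub_cancel s 1)
      simpa using this
    have hη' := hη _ hmem
    have h2 := (abs_le.1 (hlip ((1 - z.1) * z.2.1) ((1 - s) * t)
      ((1 - z.1) • z.2.2 + z.1 • u m) ((1 - s) • S + s • u m))).1
    have h3 : ‖(1 - z.1) • z.2.2 + z.1 • u m - ((1 - s) • S + s • u m)‖ ≤
        ‖(1 - z.1) • z.2.2 - (1 - s) • S‖ + |z.1 - s| * R := by
      rw [show (1 - z.1) • z.2.2 + z.1 • u m - ((1 - s) • S + s • u m) =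
        ((1 - z.1) • z.2.2 - (1 - s) • S) + (z.1 - s) • u m by module]
      refine (norm_add_le _ _).trans ?_
      rw [norm_smul, Real.norm_eq_abs]
      gcongr
      exact hu m
    have h4 : e z < ε / 2 := hz
    simp only [e] at h4
    simp only at hη'
    linarith
  filter_upwards [key] with m hm p hp
  rw [convexHull_insert ⟨_, h1⟩, mem_convexJoin] at hp
  obtain ⟨x, rfl, q, hq, a, b, ha, hb, hab, rfl⟩ := hp
  have := hm (a, q) ⟨⟨ha, by linarith⟩, hq⟩
  obtain rfl : b = 1 - a := by linarith
  simpa [add_comm] using this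

theorem exists_infinite_forall_mem_convexHull {l : Filter ℕ} [l.NeBot] (hl : l ≤ atTop)
    {u : ℕ → X} {R : ℝ} (hu : ∀ n, ‖u n‖ ≤ R) {G : ℝ → X → ℝ}
    (hlip : ∀ t t' S S', |G t S - G t' S'| ≤ R * |t - t'| + ‖S - S'‖)
    (hG : ∀ s t S, 0 ≤ s → 0 ≤ t → ∀ ε > 0, ∀ᶠ m in l, G (s + t) S - ε ≤ G t (S + s • u m))
    {r : ℝ} (hr : r < G 1 0) :
    ∃ A : Set ℕ, A.Infinite ∧ ∀ w ∈ convexHull ℝ (u '' A), r ≤ G 0 w := by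
  let F : Finset ℕ → Set (ℝ × X) := fun s => insert (1, 0) ((fun i => ((0 : ℝ), u i)) '' s)
  let P : Finset ℕ → Prop := fun s => ∃ η > r, ∀ p ∈ convexHull ℝ (F s), η ≤ G p.1 p.2
  have hstep (s : {s // P s}) (N : ℕ) : ∃ m, N ≤ m ∧ P (insert m s.1) := by
    obtain ⟨s, η, hη, hs⟩ := s
    have hev := eventually_forall_mem_convexHull_insert hu hlip hG (F := F s)
      ((s.finite_toSet.image _).insert _) (Set.mem_insert _ _) (by
        rintro p (rfl | ⟨i, -, rfl⟩) <;> simp) hs (ε := (η - r) / 2) (by linarith)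
    obtain ⟨m, hm, hNm⟩ := (hev.and (hl (eventually_ge_atTop N))).exists
    refine ⟨m, hNm, η - (η - r) / 2, by linarith, ?_⟩
    simpa only [F, Finset.coe_insert, Set.image_insert_eq, Set.insert_comm] using hm
  choose m hm hPm using hstep
  have hP0 : P ∅ := ⟨G 1 0, hr, by simp [F]⟩
  let f : ℕ → {s // P s} := fun k => Nat.rec ⟨∅, hP0⟩ (fun k s => ⟨insert (m s k) s.1, hPm s k⟩) k
  have hf (k : ℕ) : (f (k + 1)).1 = insert (m (f k) k) (f k).1 := rfl
  have hmono : Monotone fun k => ((f k).1 : Set ℕ) := monotone_nat_of_le_succ fun k => by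
    rw [hf]
    exact_mod_cast Finset.subset_insert _ _
  refine ⟨⋃ k, (f k).1, Set.infinite_of_forall_exists_gt fun k => ?_, fun w hw => ?_⟩
  · refine ⟨m (f (k + 1)) (k + 1), Set.mem_iUnion.2 ⟨k + 1 + 1, ?_⟩, hm _ _⟩
    exact Finset.mem_coe.2 (Finset.mem_insert_self (m (f (k + 1)) (k + 1)) (f (k + 1)).1)
  · have hmono' : Monotone fun k => convexHull ℝ (u '' (f k).1) := fun i j hij =>
      convexHull_mono (Set.image_mono (hmono hij))
    have hsub : u '' (⋃ k, ((f k).1 : Set ℕ)) ⊆ ⋃ k, convexHull ℝ (u '' (f k).1) := by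
      rw [Set.image_iUnion]
      exact Set.iUnion_mono fun k => subset_convexHull ℝ _
    obtain ⟨k, hk⟩ := Set.mem_iUnion.1 (convexHull_min hsub
      (hmono'.directed_le.convex_iUnion fun k => convex_convexHull ℝ _) hw)
    have hk' : ((0 : ℝ), w) ∈ convexHull ℝ (F (f k).1) := by
      refine convexHull_min (t := LinearMap.inr ℝ ℝ X ⁻¹' convexHull ℝ (F (f k).1)) ?_
        ((convex_convexHull ℝ _).linear_preimage _) hk
      rintro _ ⟨i, hi, rfl⟩
      exact subset_convexHull ℝ _ (Set.mem_insert_of_mem _ ⟨i, hi, rfl⟩)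
    obtain ⟨η, hη, h⟩ := (f k).2
    exact hη.le.trans (h _ hk')

theorem IterLim2.tendsto_curry {F : ℕ → ℕ → ℝ} {L : ℝ} (h : IterLim2 F L) {l : Filter ℕ}
    (hl : l ≤ atTop) : Tendsto (fun p : ℕ × ℕ => F p.1 p.2) (l.curry l) (𝓝 L) := by
  obtain ⟨g, hg, hgL⟩ := h
  rw [Metric.tendsto_nhds]
  intro ε hε
  rw [eventually_curry_iff]
  filter_upwards [Metric.tendsto_nhds.1 (hgL.mono_left hl) (ε / 2) (half_pos hε)] with m hm
  filter_upwards [Metric.tendsto_nhds.1 ((hg m).mono_left hl) (ε / 2) (half_pos hε)] with n hn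
  linarith [dist_triangle (F m n) (g m) L]

theorem tendsto_triangleDefect_of_renorm {c : ℕ → X} (hc : DenseRange c) {U : Filter ℕ}
    (hU : U ≤ atTop) {x y : ℕ → X} (hx : NormalizedW (renorm c).toFun x)
    (hy : NormalizedW (renorm c).toFun y)
    (h : IterLim2 (fun m n => (renorm c).toFun (x m + y n)) 2) {a b : ℝ}
    (ha : Tendsto (fun n => ‖x n‖) U (𝓝 a)) (hb : Tendsto (fun n => ‖y n‖) U (𝓝 b)) (d : X) :
    Tendsto (fun p : ℕ × ℕ => triangleDefect (a • d + x p.1) (b • d + y p.2)) (U.curry U)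
      (𝓝 0) := by
  have hlim : Tendsto (fun p : ℕ × ℕ => (renorm c).toFun (x p.1) + (renorm c).toFun (y p.2) -
      (renorm c).toFun (x p.1 + y p.2)) (U.curry U) (𝓝 0) := by
    have := (h.tendsto_curry hU).const_sub 2
    rw [sub_self] at this
    refine this.congr fun p => ?_
    rw [hx p.1, hy p.2]
    norm_num
  have h0 : Tendsto (fun p : ℕ × ℕ => triangleDefect (x p.1) (y p.2)) (U.curry U) (𝓝 0) :=
    squeeze_zero (fun p => triangleDefect_nonneg _ _)
      (fun p => (renorm_defect c (x p.1) (y p.2)).1) hlim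
  refine tendsto_triangleDefect_of_denseRange hc (fun k => ?_) d
  refine tendsto_triangleDefect_of_translateNorm ha.curry_fst hb.curry_snd h0 ?_
  have hlim' := hlim.const_mul (renormWeight c k)⁻¹
  rw [mul_zero] at hlim'
  refine squeeze_zero (fun p => sub_nonneg.2 (translateNorm_add_le _ _ _)) (fun p => ?_) hlim'
  rw [← div_eq_inv_mul, le_div_iff₀ (renormWeight_pos c k), mul_comm]
  exact (renorm_defect c (x p.1) (y p.2)).2 k

/-- Normalized sequences for `renorm` whose sums have norms with iterated limit `2` generate
positive cones like that of `ℓ₁`. -/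
theorem exists_infinite_forall_mem_convexHull_of_renorm {c : ℕ → X} (hc : DenseRange c)
    {x y : ℕ → X} (hx : NormalizedW (renorm c).toFun x) (hy : NormalizedW (renorm c).toFun y)
    (h : IterLim2 (fun m n => (renorm c).toFun (x m + y n)) 2) :
    ∃ A : Set ℕ, A.Infinite ∧ ∃ r > 0, ∀ w ∈ convexHull ℝ (x '' A), r ≤ ‖w‖ := by
  set U : Ultrafilter ℕ := hyperfilter ℕ
  have hU : (U : Filter ℕ) ≤ atTop := Nat.hyperfilter_le_atTop
  have hle (z : X) : ‖z‖ ≤ (renorm c).toFun z :=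
    le_add_of_nonneg_right (tsum_nonneg fun k =>
      mul_nonneg (renormWeight_pos c k).le (translateNorm_nonneg _ _))
  obtain ⟨B, hB, hBle⟩ := (renorm c).upper'
  have hbd (z : ℕ → X) (hz : NormalizedW (renorm c).toFun z) :
      (∀ n, ‖z n‖ ≤ 1) ∧ ∃ a > 0, Tendsto (fun n => ‖z n‖) U (𝓝 a) := by
    have h1 n : ‖z n‖ ≤ 1 := hz n ▸ hle (z n)
    obtain ⟨a, ha⟩ := U.exists_tendsto_of_bounded (f := fun n => ‖z n‖) (B := 1)
      fun n => by rw [abs_norm]; exact h1 n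
    refine ⟨h1, a, (inv_pos.2 hB).trans_le (ge_of_tendsto' ha fun n => ?_), ha⟩
    rw [inv_le_iff_one_le_mul₀' hB, ← hz n]
    exact hBle (z n)
  obtain ⟨hx1, a, ha0, ha⟩ := hbd x hx
  obtain ⟨hy1, b, hb0, hb⟩ := hbd y hy
  set R : ℝ := max a⁻¹ b⁻¹
  have hu n : ‖a⁻¹ • x n‖ ≤ R := by
    rw [norm_smul, Real.norm_of_nonneg (inv_pos.2 ha0).le]
    exact (mul_le_of_le_one_right (inv_pos.2 ha0).le (hx1 n)).trans (le_max_left _ _)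
  have hv n : ‖b⁻¹ • y n‖ ≤ R := by
    rw [norm_smul, Real.norm_of_nonneg (inv_pos.2 hb0).le]
    exact (mul_le_of_le_one_right (inv_pos.2 hb0).le (hy1 n)).trans (le_max_right _ _)
  have hone (z : ℕ → X) (r : ℝ) (hr : 0 < r) (hz : Tendsto (fun n => ‖z n‖) U (𝓝 r)) :
      Tendsto (fun n => ‖r⁻¹ • z n‖) U (𝓝 1) := by
    simpa [norm_smul, abs_of_pos hr, hr.ne'] using hz.const_mul r⁻¹
  obtain ⟨G, hG1, hGlim, hG⟩ := exists_type_of_tendsto_triangleDefect U hu hv (hone x a ha0 ha)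
    (hone y b hb0 hb) fun d => by
      have := tendsto_triangleDefect_smul (tendsto_triangleDefect_of_renorm hc hU hx hy h ha hb d)
        (inv_pos.2 ha0).le (inv_pos.2 hb0).le
      simpa [smul_add, ha0.ne', hb0.ne', add_comm] using this
  have hlip (t t' : ℝ) (S S' : X) : |G t S - G t' S'| ≤ R * |t - t'| + ‖S - S'‖ := by
    refine le_of_tendsto' ((hGlim t S).sub (hGlim t' S')).abs fun n => ?_
    refine (abs_norm_sub_norm_le _ _).trans ?_
    rw [show t • b⁻¹ • y n + S - (t' • b⁻¹ • y n + S') =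
      (t - t') • b⁻¹ • y n + (S - S') by module]
    refine (norm_add_le _ _).trans ?_
    rw [norm_smul, Real.norm_eq_abs, mul_comm]
    gcongr
    exact hv n
  have hG0 (w : X) : G 0 w = ‖w‖ := tendsto_nhds_unique (hGlim 0 w) (by simp)
  obtain ⟨A, hA, hAw⟩ := exists_infinite_forall_mem_convexHull hU hu hlip hG
    (r := 1 / 2) (by rw [hG1]; norm_num)
  refine ⟨A, hA, 1 / 2 * a, by positivity, fun w hw => ?_⟩
  have hmem : a⁻¹ • w ∈ convexHull ℝ ((fun n => a⁻¹ • x n) '' A) := by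
    have := Set.smul_mem_smul_set (a := a⁻¹) hw
    rwa [← convexHull_smul, ← Set.image_smul, Set.image_image] at this
  have := hAw _ hmem
  rw [hG0, norm_smul, Real.norm_of_nonneg (inv_pos.2 ha0).le, ← div_eq_inv_mul,
    le_div_iff₀ ha0] at this
  exact this

theorem IsCBasicW.exists_isCBasic {N : EquivNorm X} {C : ℝ} {x : ℕ → X}
    (h : IsCBasicW N.toFun C x) : ∃ C', IsCBasic C' x := by
  obtain ⟨A, hA, hAle⟩ := N.lower'
  obtain ⟨B, hB, hBle⟩ := N.upper'
  refine ⟨A⁻¹ * (|C| * B), h.1, fun n m hnm a => ?_⟩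
  rw [mul_assoc, ← div_eq_inv_mul, le_div_iff₀ hA, mul_comm, mul_assoc]
  have hnonneg : 0 ≤ N.toFun (∑ i ∈ Finset.range m, a i • x i) :=
    (mul_nonneg hA.le (norm_nonneg _)).trans (hAle _)
  exact (hAle _).trans ((h.2 n m hnm a).trans (mul_le_mul (le_abs_self C) (hBle _) hnonneg
    (abs_nonneg C)))


/-- Theorem 4.5: every separable infinite-dimensional Banach space has an equivalent norm
`N` such that if there are `N`-normalized basic sequences `x`, `y` with
`lim_m lim_n N (x m + y n) = 2`, then `X` is not reflexive. -/
theorem stmt_16 (X : Type*) [NormedAddCommGroup X] [NormedSpace ℝ X] [CompleteSpace X]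
    [TopologicalSpace.SeparableSpace X] (hinf : ¬ FiniteDimensional ℝ X) :
    ∃ N : EquivNorm X,
      ∀ x y : ℕ → X,
        NormalizedW N.toFun x → NormalizedW N.toFun y →
        (∃ Cx : ℝ, IsCBasicW N.toFun Cx x) → (∃ Cy : ℝ, IsCBasicW N.toFun Cy y) →
        IterLim2 (fun m n => N.toFun (x m + y n)) 2 →
        ¬ IsReflexive X := by
  refine ⟨renorm (TopologicalSpace.denseSeq X), fun x y hx hy hbx _ hlim hr => ?_⟩
  obtain ⟨C, hC⟩ := hbx
  obtain ⟨C', hC'⟩ := hC.exists_isCBasic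
  obtain ⟨A, hA, hAle⟩ := (renorm (TopologicalSpace.denseSeq X)).lower'
  obtain ⟨I, hI, r, hr0, hIr⟩ := exists_infinite_forall_mem_convexHull_of_renorm
    (TopologicalSpace.denseRange_denseSeq X) hx hy hlim
  obtain ⟨w, hw, hwr⟩ := hC'.exists_mem_convexHull_norm_lt hr (R := A⁻¹) (fun i => by
    rw [← one_div, le_div_iff₀ hA, mul_comm, ← hx i]
    exact hAle (x i)) hI hr0
  exact (hIr w hw).not_gt hwr
end
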